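/- Let p, q ∈ ℤ² with p∧q ≠ 0 and suppose q is of type I₀ relative to p, and fix λ > 0 and ν > 0. For n ≥ 0 define u_n^{(1)}(λ,ν) = a_n(λ,ν) + lim_{k→∞}[a_{n+1}(λ,ν); a_{n+2}(λ,ν); …; a_{n+k}(λ,ν)], and for n ≤ 0 define u_n^{(2)}(λ,ν) = −lim_{k→∞}[a_{n−1}(λ,ν); a_{n−2}(λ,ν); …; a_{n−k}(λ,ν)]. Then all these limits exist, u_n^{(1)}(λ,ν) → +∞ as n → +∞, and u_n^{(2)}(λ,ν) → 0 as n → −∞. -/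

import Mathlib

open Filter Finset Topology

noncomputable section

/-- Squared Euclidean norm of an integer vector. -/
def nsq (v : ℤ × ℤ) : ℝ := (v.1 : ℝ) ^ 2 + (v.2 : ℝ) ^ 2

/-- Wedge (cross) product of two integer vectors. -/
def wedge (p q : ℤ × ℤ) : ℤ := p.1 * q.2 - p.2 * q.1

/-- The lattice point `q + n • p`. -/
def pt (q p : ℤ × ℤ) (n : ℤ) : ℤ × ℤ := (q.1 + n * p.1, q.2 + n * p.2)

/-- ρ_n = 1 - ‖p‖²/‖q+np‖². -/
def rho (p q : ℤ × ℤ) (n : ℤ) : ℝ := 1 - nsq p / nsq (pt q p n)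

/-- `q` is of type I₀ relative to `p`. -/
def typeI0 (p q : ℤ × ℤ) : Prop :=
  nsq q < nsq p ∧ ∀ n : ℤ, n ≠ 0 → nsq p < nsq (pt q p n)

/-- a_n(λ,ν) = (λ + ν‖q+np‖²)/ρ_n. -/
def acoef (p q : ℤ × ℤ) (lam ν : ℝ) (n : ℤ) : ℝ :=
  (lam + ν * nsq (pt q p n)) / rho p q n

/-- Membership in the weighted space ℓ²_s(ℤ). -/
def memL2s (s : ℝ) (w : ℤ → ℝ) : Prop :=
  Summable fun n : ℤ => (1 + |(n : ℝ)| ^ (2 * s)) * (w n) ^ 2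

/-- Finite continued fraction `[x₁; x₂; …; x_k] = 1/(x₁ + 1/(x₂ + ⋯ + 1/x_k))`. -/
def cfL : List ℝ → ℝ
  | [] => 0
  | x :: xs => 1 / (x + cfL xs)

def cfS (a : ℕ → ℝ) (k : ℕ) : ℝ := cfL ((List.range k).map a)

lemma cfS_def' (a : ℕ → ℝ) : cfS a = fun k => cfL ((List.range k).map a) := rfl

lemma cfS_zero (a : ℕ → ℝ) : cfS a 0 = 0 := by simp [cfS, cfL]

lemma cfS_succ (a : ℕ → ℝ) (k : ℕ) :
    cfS a (k+1) = 1 / (a 0 + cfS (fun j => a (j+1)) k) := by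
  simp only [cfS, List.range_succ_eq_map, List.map_cons, List.map_map, cfL]
  rfl

lemma cfS_nonneg (k : ℕ) : ∀ (a : ℕ → ℝ), (∀ j, 0 < a j) → 0 ≤ cfS a k := by
  induction k with
  | zero => intro a _; rw [cfS_zero]
  | succ k ih =>
    intro a ha
    rw [cfS_succ]
    have h1 := ih (fun j => a (j+1)) (fun j => ha (j+1))
    have h0 := ha 0
    positivity

lemma cfS_le (k : ℕ) (a : ℕ → ℝ) (ha : ∀ j, 0 < a j) : cfS a k ≤ 1 / a 0 := by
  have h0 := ha 0
  cases k with
  | zero => rw [cfS_zero]; positivity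
  | succ k =>
    rw [cfS_succ]
    have h1 := cfS_nonneg k (fun j => a (j+1)) (fun j => ha (j+1))
    apply one_div_le_one_div_of_le h0
    linarith

lemma two_step (c a b x y : ℝ) (hc : 0 < c) (ha : c ≤ a) (hb : c ≤ b) (hx : 0 ≤ x) (hy : 0 ≤ y) :
    |1 / (a + 1 / (b + x)) - 1 / (a + 1 / (b + y))| ≤ (1 / (1 + c^2)) * |x - y| := by
  have ha0 : 0 < a := by linarith
  have hb0 : 0 < b := by linarith
  have e : 1 / (a + 1 / (b + x)) - 1 / (a + 1 / (b + y))
      = (1 / ((1 + a * (b + x)) * (1 + a * (b + y)))) * (x - y) := by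
    have h1 : b + x ≠ 0 := by positivity
    have h2 : b + y ≠ 0 := by positivity
    have h3 : 1 + a * (b + x) ≠ 0 := by positivity
    have h4 : 1 + a * (b + y) ≠ 0 := by positivity
    have e1 : 1 / (a + 1 / (b + x)) = (b + x) / (1 + a * (b + x)) := by
      field_simp
      ring
    have e2 : 1 / (a + 1 / (b + y)) = (b + y) / (1 + a * (b + y)) := by
      field_simp
      ring
    rw [e1, e2]
    field_simp
    ring
  rw [e, abs_mul]
  apply mul_le_mul_of_nonneg_right _ (abs_nonneg _)
  rw [abs_of_nonneg (by positivity)]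
  apply one_div_le_one_div_of_le (by positivity)
  have h1 : c^2 ≤ a * (b + x) := by
    rw [sq]; exact mul_le_mul ha (by linarith) hc.le ha0.le
  have h2 : 0 ≤ a * (b + y) := by positivity
  nlinarith [mul_nonneg (sq_nonneg c) h2, mul_nonneg (sub_nonneg.2 h1) h2]

lemma cfS_diff (c : ℝ) (hc : 0 < c) (k l m : ℕ) : ∀ (a : ℕ → ℝ), (∀ j, c ≤ a j) →
    |cfS a (k + 2 * m) - cfS a (l + 2 * m)| ≤ (1 / (1 + c^2))^m * (1 / c) := by
  induction m with
  | zero =>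
    intro a ha
    have hp : ∀ j, 0 < a j := fun j => lt_of_lt_of_le hc (ha j)
    have h := one_div_le_one_div_of_le hc (ha 0)
    have h1 := cfS_nonneg k a hp
    have h2 := cfS_nonneg l a hp
    have h3 := cfS_le k a hp
    have h4 := cfS_le l a hp
    simp only [mul_zero, add_zero, pow_zero, one_mul]
    rw [abs_le]; constructor <;> linarith
  | succ m ih =>
    intro a ha
    have hp : ∀ j, 0 < a j := fun j => lt_of_lt_of_le hc (ha j)
    have e : ∀ k, k + 2 * (m+1) = (k + 2 * m) + 1 + 1 := fun k => by ring
    rw [e, e, cfS_succ, cfS_succ, cfS_succ, cfS_succ]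
    refine (two_step c _ _ _ _ hc (ha 0) (ha _) (cfS_nonneg _ _ fun j => hp _)
      (cfS_nonneg _ _ fun j => hp _)).trans ?_
    rw [pow_succ' (1 / (1 + c^2)) m, mul_assoc]
    exact mul_le_mul_of_nonneg_left (ih _ fun j => ha _) (by positivity)

lemma cfS_conv (c : ℝ) (hc : 0 < c) (a : ℕ → ℝ) (ha : ∀ j, c ≤ a j) :
    ∃ L, Tendsto (cfS a) atTop (nhds L) ∧ 0 ≤ L ∧ L ≤ 1 / a 0 := by
  have hp : ∀ j, 0 < a j := fun j => lt_of_lt_of_le hc (ha j)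
  have hC : CauchySeq (cfS a) := by
    rw [Metric.cauchySeq_iff]
    intro ε hε
    have ht : Tendsto (fun m : ℕ => (1 / (1 + c^2))^m * (1 / c)) atTop (nhds (0 * (1 / c))) := by
      apply Tendsto.mul_const
      apply tendsto_pow_atTop_nhds_zero_of_lt_one (by positivity)
      rw [div_lt_one (by positivity)]
      have := pow_pos hc 2
      linarith
    rw [zero_mul] at ht
    obtain ⟨m, hm⟩ := (ht.eventually (gt_mem_nhds hε)).exists
    refine ⟨2 * m, fun k hk l hl => ?_⟩
    obtain ⟨k', rfl⟩ := Nat.exists_eq_add_of_le' hk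
    obtain ⟨l', rfl⟩ := Nat.exists_eq_add_of_le' hl
    rw [Real.dist_eq]
    exact (cfS_diff c hc k' l' m a ha).trans_lt hm
  obtain ⟨L, hL⟩ := cauchySeq_tendsto_of_complete hC
  exact ⟨L, hL, ge_of_tendsto' hL fun k => cfS_nonneg k a hp,
    le_of_tendsto' hL fun k => cfS_le k a hp⟩

lemma acoef_ge (p q : ℤ × ℤ) (hpq : wedge p q ≠ 0)
    (hI0 : typeI0 p q) (lam ν : ℝ) (hlam : 0 < lam) (hν : 0 < ν) (n : ℤ) (hn : n ≠ 0) :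
    lam ≤ acoef p q lam ν n ∧ ν * (|(n : ℝ)| / 2 - nsq q) ≤ acoef p q lam ν n := by
  have hlt := hI0.2 n hn
  have hP : 1 ≤ nsq p := by
    have h : 1 ≤ p.1 ^ 2 + p.2 ^ 2 := by
      by_contra hcon
      have h1 : p.1 = 0 := by nlinarith [sq_nonneg p.1, sq_nonneg p.2]
      have h2 : p.2 = 0 := by nlinarith [sq_nonneg p.1, sq_nonneg p.2]
      apply hpq
      simp [wedge, h1, h2]
    unfold nsq
    exact_mod_cast h
  have hQ : 0 < nsq (pt q p n) := by linarith
  have hr0 : 0 < rho p q n := by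
    unfold rho
    rw [sub_pos, div_lt_one hQ]; exact hlt
  have hr1 : rho p q n ≤ 1 := by
    unfold rho
    have : 0 ≤ nsq p / nsq (pt q p n) := by positivity
    linarith
  have hA : lam + ν * nsq (pt q p n) ≤ acoef p q lam ν n := by
    unfold acoef
    exact le_div_self (by positivity) hr0 hr1
  have hνQ : 0 < ν * nsq (pt q p n) := by positivity
  refine ⟨by linarith, ?_⟩
  have hn1 : (1 : ℝ) ≤ |(n : ℝ)| := by exact_mod_cast Int.one_le_abs hn
  have hn2 : |(n : ℝ)| ≤ (n : ℝ)^2 := by rw [← sq_abs]; nlinarith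
  have h1 : (n : ℝ)^2 * nsq p / 2 - nsq q ≤ nsq (pt q p n) := by
    simp only [nsq, pt]
    push_cast
    nlinarith [sq_nonneg (2 * (q.1 : ℝ) + n * p.1), sq_nonneg (2 * (q.2 : ℝ) + n * p.2)]
  have h2 : (n : ℝ)^2 ≤ (n : ℝ)^2 * nsq p := le_mul_of_one_le_right (sq_nonneg _) hP
  have h3 : |(n : ℝ)| / 2 - nsq q ≤ nsq (pt q p n) := by linarith
  have := mul_le_mul_of_nonneg_left h3 hν.le
  linarith

/-- The continued fractions `u_n⁽¹⁾(λ,ν)` (for `n ≥ 0`) and `u_n⁽²⁾(λ,ν)` (for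
`n ≤ 0`) all converge, `u_n⁽¹⁾ → +∞` as `n → +∞`, and `u_n⁽²⁾ → 0` as
`n → -∞`. -/
theorem un_continuedFraction_limits (p q : ℤ × ℤ) (hpq : wedge p q ≠ 0)
    (hI0 : typeI0 p q) (lam ν : ℝ) (hlam : 0 < lam) (hν : 0 < ν) :
    ∃ U₁ U₂ : ℤ → ℝ,
      (∀ n : ℤ, 0 ≤ n →
        Tendsto (fun k : ℕ =>
            cfL ((List.range k).map fun j => acoef p q lam ν (n + 1 + (j : ℤ))))
          atTop (nhds (U₁ n - acoef p q lam ν n))) ∧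
      (∀ n : ℤ, n ≤ 0 →
        Tendsto (fun k : ℕ =>
            cfL ((List.range k).map fun j => acoef p q lam ν (n - 1 - (j : ℤ))))
          atTop (nhds (-U₂ n))) ∧
      Tendsto U₁ atTop atTop ∧
      Tendsto U₂ atBot (nhds 0) := by
  have key := acoef_ge p q hpq hI0 lam ν hlam hν
  have hb : Tendsto (fun x : ℝ => ν * (x / 2 - nsq q)) atTop atTop := by
    apply Tendsto.const_mul_atTop hν
    apply tendsto_atTop_add_const_right
    exact tendsto_id.atTop_div_const two_pos
  have hT : Tendsto (acoef p q lam ν) atTop atTop := by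
    refine tendsto_atTop_mono' _ ?_ (hb.comp (tendsto_abs_atTop_atTop.comp
      (tendsto_intCast_atTop_atTop (R := ℝ))))
    filter_upwards [eventually_gt_atTop 0] with n hn
    exact (key n hn.ne').2
  have hB : Tendsto (acoef p q lam ν) atBot atTop := by
    refine tendsto_atTop_mono' _ ?_ (hb.comp (tendsto_abs_atBot_atTop.comp
      (tendsto_intCast_atBot_iff (R := ℝ) |>.2 tendsto_id)))
    filter_upwards [eventually_lt_atBot 0] with n hn
    exact (key n hn.ne).2
  have h1 : ∀ n : ℤ, ∃ u : ℝ, 0 ≤ n → (Tendsto (fun k : ℕ =>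
            cfL ((List.range k).map fun j => acoef p q lam ν (n + 1 + (j : ℤ))))
          atTop (nhds (u - acoef p q lam ν n)) ∧ acoef p q lam ν n ≤ u) := by
    intro n
    by_cases hn : 0 ≤ n
    · obtain ⟨L, hL, h0, -⟩ := cfS_conv lam hlam (fun j => acoef p q lam ν (n + 1 + (j : ℤ)))
        (fun j => (key _ (by omega)).1)
      refine ⟨L + acoef p q lam ν n, fun _ => ⟨?_, by linarith⟩⟩
      rw [add_sub_cancel_right]
      simpa [cfS_def', List.map_eq_flatMap, List.flatMap_assoc] using hL
    · exact ⟨0, fun h => absurd h hn⟩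
  have h2 : ∀ n : ℤ, ∃ u : ℝ, n ≤ 0 → (Tendsto (fun k : ℕ =>
            cfL ((List.range k).map fun j => acoef p q lam ν (n - 1 - (j : ℤ))))
          atTop (nhds (-u)) ∧ |u| ≤ (acoef p q lam ν (n - 1))⁻¹) := by
    intro n
    by_cases hn : n ≤ 0
    · obtain ⟨L, hL, h0, h3⟩ := cfS_conv lam hlam (fun j => acoef p q lam ν (n - 1 - (j : ℤ)))
        (fun j => (key _ (by omega)).1)
      refine ⟨-L, fun _ => ⟨?_, ?_⟩⟩
      · rw [neg_neg]
        simpa [cfS_def', List.map_eq_flatMap, List.flatMap_assoc] using hL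
      · rw [abs_neg, abs_of_nonneg h0]
        simpa using h3
    · exact ⟨0, fun h => absurd h hn⟩
  choose U₁ hU₁ using h1
  choose U₂ hU₂ using h2
  refine ⟨U₁, U₂, fun n hn => (hU₁ n hn).1, fun n hn => (hU₂ n hn).1, ?_, ?_⟩
  · refine tendsto_atTop_mono' _ ?_ hT
    filter_upwards [eventually_ge_atTop 0] with n hn
    exact (hU₁ n hn).2
  · have hs : Tendsto (fun n : ℤ => n - 1) atBot atBot :=
      tendsto_atBot_mono (fun n => by simp) tendsto_id
    refine squeeze_zero_norm' ?_ (tendsto_inv_atTop_zero.comp (hB.comp hs))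
    filter_upwards [eventually_le_atBot 0] with n hn
    exact (hU₂ n hn).2
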